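/- Let n, m be positive integers and let B_1, ..., B_m be real symmetric n×n matrices. Then the sum over all pairs r, s from 1 to m of the squared Frobenius norms of the commutators, Σ_{r,s=1}^m ‖[B_r, B_s]‖², is at most the square of Σ_{r=1}^m ‖B_r‖², i.e. Σ_{r,s=1}^m ‖[B_r,B_s]‖² ≤ (Σ_{r=1}^m ‖B_r‖²)². -/

import Mathlib

open Matrix BigOperators

/-- Squared Frobenius norm of a real square matrix. -/
def frobSq {n : ℕ} (A : Matrix (Fin n) (Fin n) ℝ) : ℝ := ∑ i, ∑ j, (A i j) ^ 2

/-- Commutator of two square matrices. -/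
def matComm {n : ℕ} (A B : Matrix (Fin n) (Fin n) ℝ) : Matrix (Fin n) (Fin n) ℝ :=
  A * B - B * A


section SquaredDifferences

variable {ι : Type*} [Fintype ι]

/-- The Laplacian of a star with `k` leaves has largest eigenvalue at most `k + 1`. -/
lemma sum_sq_sub_center_le [DecidableEq ι] (x : ι → ℝ) (i : ι) (J : Finset ι) (hi : i ∉ J) :
    ∑ j ∈ J, ((x i - x j) ^ 2 - ∑ k, x k ^ 2) ≤ ∑ k, x k ^ 2 := by
  have hL : x i ^ 2 + ∑ j ∈ J, x j ^ 2 ≤ ∑ k, x k ^ 2 := by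
    rw [← Finset.sum_insert (f := fun k => x k ^ 2) hi]
    exact Finset.sum_le_univ_sum_of_nonneg fun k => sq_nonneg _
  have hcs : (∑ j ∈ J, x j) ^ 2 ≤ J.card * ∑ j ∈ J, x j ^ 2 := sq_sum_le_card_mul_sum_sq
  have hexp : ∑ j ∈ J, ((x i - x j) ^ 2 - ∑ k, x k ^ 2)
      = J.card * x i ^ 2 - 2 * x i * ∑ j ∈ J, x j + ∑ j ∈ J, x j ^ 2
        - J.card * ∑ k, x k ^ 2 := by
    simp only [sub_sq, Finset.sum_sub_distrib, Finset.sum_add_distrib, Finset.sum_const,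
      nsmul_eq_mul, Finset.mul_sum]
  have hc : (0 : ℝ) ≤ J.card + 1 := by positivity
  rw [hexp]
  nlinarith [mul_le_mul_of_nonneg_left hL hc, sq_nonneg (x i + ∑ j ∈ J, x j)]

lemma sq_sub_le_two_mul_sum_sq [DecidableEq ι] (x : ι → ℝ) {i j : ι} (h : i ≠ j) :
    (x i - x j) ^ 2 ≤ 2 * ∑ k, x k ^ 2 := by
  have h2 : x i ^ 2 + x j ^ 2 ≤ ∑ k, x k ^ 2 := by
    rw [← Finset.sum_pair (f := fun k => x k ^ 2) h]
    exact Finset.sum_le_univ_sum_of_nonneg fun k => sq_nonneg _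
  nlinarith [sq_nonneg (x i + x j)]

/-- Two ordered pairs whose squared differences both exceed `∑ x k ^ 2` share their first or
their second entry. -/
lemma fst_eq_or_snd_eq_of_sum_sq_lt [DecidableEq ι] (x : ι → ℝ) {i j k l : ι}
    (hij : 0 < x i - x j) (hij' : ∑ k, x k ^ 2 < (x i - x j) ^ 2)
    (hkl : 0 < x k - x l) (hkl' : ∑ k, x k ^ 2 < (x k - x l) ^ 2) : i = k ∨ j = l := by
  by_contra! h
  obtain ⟨hik, hjl⟩ := h
  have hne : ∀ {a b : ι}, 0 < x a - x b → a ≠ b := by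
    rintro a _ h rfl
    simp at h
  by_cases hil : i = l
  · subst hil
    have := sq_sub_le_two_mul_sum_sq x (hne (a := k) (b := j) (by linarith))
    nlinarith [mul_pos hij hkl]
  by_cases hjk : j = k
  · subst hjk
    have := sq_sub_le_two_mul_sum_sq x (hne (a := i) (b := l) (by linarith))
    nlinarith [mul_pos hij hkl]
  have hsum : x i ^ 2 + (x j ^ 2 + (x k ^ 2 + x l ^ 2)) ≤ ∑ k, x k ^ 2 := by
    have h4 : ∑ a ∈ ({i, j, k, l} : Finset ι), x a ^ 2
        = x i ^ 2 + (x j ^ 2 + (x k ^ 2 + x l ^ 2)) := by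
      rw [Finset.sum_insert (by simp [hne hij, hik, hil]), Finset.sum_insert (by simp [hjk, hjl]),
        Finset.sum_pair (hne hkl)]
    rw [← h4]
    exact Finset.sum_le_univ_sum_of_nonneg fun k => sq_nonneg _
  nlinarith [sq_nonneg (x i + x j), sq_nonneg (x k + x l)]

/-- The total excess of the squared differences over `∑ x k ^ 2`. -/
lemma sum_excess_le [DecidableEq ι] (x : ι → ℝ) :
    ∑ p : ι × ι with 0 < x p.1 - x p.2 ∧ ∑ k, x k ^ 2 < (x p.1 - x p.2) ^ 2,
      ((x p.1 - x p.2) ^ 2 - ∑ k, x k ^ 2) ≤ ∑ k, x k ^ 2 := by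
  set P : Finset (ι × ι) :=
    {p : ι × ι | 0 < x p.1 - x p.2 ∧ ∑ k, x k ^ 2 < (x p.1 - x p.2) ^ 2} with hP
  have hmem : ∀ p ∈ P, 0 < x p.1 - x p.2 ∧ ∑ k, x k ^ 2 < (x p.1 - x p.2) ^ 2 := by
    intro p hp
    simpa [hP] using hp
  have hshare : ∀ p ∈ P, ∀ q ∈ P, p.1 = q.1 ∨ p.2 = q.2 := fun p hp q hq =>
    fst_eq_or_snd_eq_of_sum_sq_lt x (hmem p hp).1 (hmem p hp).2 (hmem q hq).1 (hmem q hq).2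
  rcases P.eq_empty_or_nonempty with h | hne
  · rw [h, Finset.sum_empty]
    exact Finset.sum_nonneg fun k _ => sq_nonneg _
  have hstar : (∃ i, ∀ p ∈ P, p.1 = i) ∨ ∃ j, ∀ p ∈ P, p.2 = j := by
    by_contra! hcon
    obtain ⟨p, hp⟩ := hne
    obtain ⟨q, hq, hq1⟩ := hcon.1 p.1
    obtain ⟨r, hr, hr2⟩ := hcon.2 p.2
    have h1 := hshare p hp q hq
    have h2 := hshare p hp r hr
    have h3 := hshare q hq r hr
    grind
  rcases hstar with ⟨i, hi⟩ | ⟨j, hj⟩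
  · have hinj : Set.InjOn Prod.snd (P : Set (ι × ι)) := by
      intro p hp q hq h
      exact Prod.ext ((hi p hp).trans (hi q hq).symm) h
    have hnot : i ∉ P.image Prod.snd := by
      intro h
      obtain ⟨p, hp, hpi⟩ := Finset.mem_image.1 h
      have := (hmem p hp).1
      rw [hi p hp, hpi] at this
      simp at this
    have key := sum_sq_sub_center_le x i _ hnot
    rw [Finset.sum_image hinj] at key
    refine le_trans (le_of_eq (Finset.sum_congr rfl fun p hp => ?_)) key
    rw [hi p hp]
  · have hinj : Set.InjOn Prod.fst (P : Set (ι × ι)) := by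
      intro p hp q hq h
      exact Prod.ext h ((hj p hp).trans (hj q hq).symm)
    have hnot : j ∉ P.image Prod.fst := by
      intro h
      obtain ⟨p, hp, hpj⟩ := Finset.mem_image.1 h
      have := (hmem p hp).1
      rw [hj p hp, hpj] at this
      simp at this
    have key := sum_sq_sub_center_le x j _ hnot
    rw [Finset.sum_image hinj] at key
    refine le_trans (le_of_eq (Finset.sum_congr rfl fun p hp => ?_)) key
    rw [hj p hp]
    ring

/-- A weighted sum of squared differences exceeds the trivial bound by at most twice the largest
off-diagonal weight. -/
lemma sum_sq_sub_mul_le [DecidableEq ι] (x : ι → ℝ) (a : ι → ι → ℝ) (M : ℝ)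
    (hM : 0 ≤ M) (ha : ∀ i j, 0 ≤ a i j)
    (haM : ∀ i j, i ≠ j → a i j ≤ M) :
    ∑ i, ∑ j, (x i - x j) ^ 2 * a i j ≤ (∑ k, x k ^ 2) * (∑ i, ∑ j, a i j + 2 * M) := by
  set L := ∑ k, x k ^ 2 with hL
  have hL0 : 0 ≤ L := Finset.sum_nonneg fun k _ => sq_nonneg _
  have h1 := sum_excess_le x
  have h2 := sum_excess_le (fun k => - x k)
  simp only [neg_sq, Finset.sum_filter, ← hL] at h1 h2
  have hpt : ∀ p : ι × ι, ((x p.1 - x p.2) ^ 2 - L) * a p.1 p.2 ≤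
      (if 0 < x p.1 - x p.2 ∧ L < (x p.1 - x p.2) ^ 2 then (x p.1 - x p.2) ^ 2 - L else 0) * M +
      (if 0 < -x p.1 - -x p.2 ∧ L < (-x p.1 - -x p.2) ^ 2
        then (-x p.1 - -x p.2) ^ 2 - L else 0) * M := by
    rintro ⟨i, j⟩
    have hneg : (-x i - -x j) ^ 2 = (x i - x j) ^ 2 := by ring
    simp only [hneg]
    by_cases hlt : L < (x i - x j) ^ 2
    · have hne : i ≠ j := by
        rintro rfl
        simp at hlt
        linarith
      have hb := mul_le_mul_of_nonneg_left (haM i j hne) (sub_pos.2 hlt).le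
      rcases lt_trichotomy (x i - x j) 0 with h | h | h
      · simp only [hlt, and_true, if_neg h.not_gt, if_pos (show 0 < -x i - -x j by linarith)]
        linarith
      · rw [h] at hlt
        norm_num at hlt
        linarith
      · simp only [hlt, and_true, if_pos h, if_neg (show ¬ 0 < -x i - -x j by linarith)]
        linarith
    · simp only [hlt, and_false, if_false]
      nlinarith [ha i j]
  have hsum := Finset.sum_le_sum fun p (_ : p ∈ (Finset.univ : Finset (ι × ι))) => hpt p
  rw [Finset.sum_add_distrib, ← Finset.sum_mul, ← Finset.sum_mul, Fintype.sum_prod_type] at hsum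
  simp only [sub_mul, Finset.sum_sub_distrib, ← Finset.mul_sum] at hsum
  nlinarith [mul_le_mul_of_nonneg_right h1 hM, mul_le_mul_of_nonneg_right h2 hM]

end SquaredDifferences

section Frobenius

variable {n : ℕ}

/-- The Frobenius inner product of real square matrices. -/
def frobInner (A B : Matrix (Fin n) (Fin n) ℝ) : ℝ := ∑ i, ∑ j, A i j * B i j

lemma frobInner_self (A : Matrix (Fin n) (Fin n) ℝ) : frobInner A A = frobSq A := by
  simp only [frobInner, frobSq, sq]

lemma frobInner_comm (A B : Matrix (Fin n) (Fin n) ℝ) : frobInner A B = frobInner B A := by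
  simp only [frobInner, mul_comm]

lemma frobInner_eq_trace (A B : Matrix (Fin n) (Fin n) ℝ) : frobInner A B = (Aᵀ * B).trace := by
  simp only [frobInner, trace, diag_apply, mul_apply, transpose_apply]
  exact Finset.sum_comm

lemma frobInner_add_left (A B C : Matrix (Fin n) (Fin n) ℝ) :
    frobInner (A + B) C = frobInner A C + frobInner B C := by
  simp only [frobInner, Matrix.add_apply, add_mul, Finset.sum_add_distrib]

lemma frobInner_smul_left (c : ℝ) (A B : Matrix (Fin n) (Fin n) ℝ) :
    frobInner (c • A) B = c * frobInner A B := by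
  simp only [frobInner, Matrix.smul_apply, smul_eq_mul, mul_assoc, Finset.mul_sum]

lemma frobInner_smul_right (c : ℝ) (A B : Matrix (Fin n) (Fin n) ℝ) :
    frobInner A (c • B) = c * frobInner A B := by
  rw [frobInner_comm, frobInner_smul_left, frobInner_comm]

lemma frobInner_sub_left (A B C : Matrix (Fin n) (Fin n) ℝ) :
    frobInner (A - B) C = frobInner A C - frobInner B C := by
  simp only [frobInner, Matrix.sub_apply, sub_mul, Finset.sum_sub_distrib]

lemma frobInner_sub_right (A B C : Matrix (Fin n) (Fin n) ℝ) :
    frobInner A (B - C) = frobInner A B - frobInner A C := by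
  simp only [frobInner, Matrix.sub_apply, mul_sub, Finset.sum_sub_distrib]

lemma frobInner_sum_left {ι : Type*} (s : Finset ι) (A : ι → Matrix (Fin n) (Fin n) ℝ)
    (B : Matrix (Fin n) (Fin n) ℝ) :
    frobInner (∑ r ∈ s, A r) B = ∑ r ∈ s, frobInner (A r) B := by
  simp only [frobInner_eq_trace, transpose_sum, Finset.sum_mul, trace_sum]

lemma frobSq_nonneg (A : Matrix (Fin n) (Fin n) ℝ) : 0 ≤ frobSq A :=
  Finset.sum_nonneg fun _ _ => Finset.sum_nonneg fun _ _ => sq_nonneg _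

lemma frobSq_smul (c : ℝ) (A : Matrix (Fin n) (Fin n) ℝ) : frobSq (c • A) = c ^ 2 * frobSq A := by
  simp only [← frobInner_self, frobInner_smul_left, frobInner_smul_right]
  ring

lemma frobSq_add_smul (A B : Matrix (Fin n) (Fin n) ℝ) (t : ℝ) :
    frobSq (A + t • B) = frobSq A + 2 * t * frobInner A B + t ^ 2 * frobSq B := by
  simp only [frobSq, frobInner, Finset.mul_sum, ← Finset.sum_add_distrib, Matrix.add_apply,
    Matrix.smul_apply, smul_eq_mul]
  refine Finset.sum_congr rfl fun i _ => Finset.sum_congr rfl fun j _ => ?_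
  ring

lemma frobInner_sq_le (A B : Matrix (Fin n) (Fin n) ℝ) :
    frobInner A B ^ 2 ≤ frobSq A * frobSq B := by
  simp only [frobInner, frobSq, ← Fintype.sum_prod_type']
  exact Finset.sum_mul_sq_le_sq_mul_sq _ _ _

lemma frobSq_eq_zero {A : Matrix (Fin n) (Fin n) ℝ} (h : frobSq A = 0) : A = 0 := by
  ext i j
  have h1 := (Finset.sum_eq_zero_iff_of_nonneg
    fun i _ => Finset.sum_nonneg fun j _ => sq_nonneg (A i j)).1 h i (Finset.mem_univ i)
  have h2 := (Finset.sum_eq_zero_iff_of_nonneg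
    fun j _ => sq_nonneg (A i j)).1 h1 j (Finset.mem_univ j)
  simpa using h2

/-- Orthogonal conjugation preserves the Frobenius inner product. -/
lemma frobInner_conj {U : Matrix (Fin n) (Fin n) ℝ} (hU : U * Uᵀ = 1)
    (A B : Matrix (Fin n) (Fin n) ℝ) :
    frobInner (Uᵀ * A * U) (Uᵀ * B * U) = frobInner A B := by
  have h : (Uᵀ * A * U)ᵀ * (Uᵀ * B * U) = Uᵀ * (Aᵀ * B * U) := by
    calc (Uᵀ * A * U)ᵀ * (Uᵀ * B * U) = Uᵀ * (Aᵀ * ((U * Uᵀ) * (B * U))) := by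
          simp only [transpose_mul, transpose_transpose, Matrix.mul_assoc]
      _ = Uᵀ * (Aᵀ * B * U) := by rw [hU, Matrix.one_mul, Matrix.mul_assoc]
  rw [frobInner_eq_trace, frobInner_eq_trace, h, trace_mul_comm, Matrix.mul_assoc, hU,
    Matrix.mul_one]

lemma frobSq_conj {U : Matrix (Fin n) (Fin n) ℝ} (hU : U * Uᵀ = 1)
    (A : Matrix (Fin n) (Fin n) ℝ) : frobSq (Uᵀ * A * U) = frobSq A := by
  rw [← frobInner_self, frobInner_conj hU, frobInner_self]

lemma matComm_conj {U : Matrix (Fin n) (Fin n) ℝ} (hU : U * Uᵀ = 1)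
    (A B : Matrix (Fin n) (Fin n) ℝ) :
    matComm (Uᵀ * A * U) (Uᵀ * B * U) = Uᵀ * matComm A B * U := by
  have h : ∀ X Y : Matrix (Fin n) (Fin n) ℝ,
      (Uᵀ * X * U) * (Uᵀ * Y * U) = Uᵀ * (X * Y) * U := fun X Y => by
    calc (Uᵀ * X * U) * (Uᵀ * Y * U) = Uᵀ * X * (U * Uᵀ) * Y * U := by
          simp only [Matrix.mul_assoc]
      _ = Uᵀ * (X * Y) * U := by rw [hU, Matrix.mul_one, Matrix.mul_assoc Uᵀ]
  simp only [matComm, h, Matrix.mul_sub, Matrix.sub_mul]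

lemma frobSq_matComm_diagonal (x : Fin n → ℝ) (A : Matrix (Fin n) (Fin n) ℝ) :
    frobSq (matComm (diagonal x) A) = ∑ i, ∑ j, (x i - x j) ^ 2 * A i j ^ 2 := by
  simp only [frobSq, matComm, Matrix.sub_apply, diagonal_mul, mul_diagonal]
  refine Finset.sum_congr rfl fun i _ => Finset.sum_congr rfl fun j _ => ?_
  ring

lemma frobSq_diagonal (x : Fin n → ℝ) : frobSq (diagonal x) = ∑ i, x i ^ 2 := by
  simp [frobSq, diagonal_apply, ite_pow]

/-- A real symmetric matrix is orthogonally diagonalizable. -/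
lemma exists_orthogonal_conj_eq_diagonal {A : Matrix (Fin n) (Fin n) ℝ} (hA : Aᵀ = A) :
    ∃ (U : Matrix (Fin n) (Fin n) ℝ) (x : Fin n → ℝ), U * Uᵀ = 1 ∧ Uᵀ * A * U = diagonal x := by
  have hH : A.IsHermitian := by rwa [IsHermitian, conjTranspose_eq_transpose_of_trivial]
  refine ⟨hH.eigenvectorUnitary, hH.eigenvalues, ?_, ?_⟩
  · have := Unitary.coe_mul_star_self hH.eigenvectorUnitary
    rwa [Unitary.coe_star, star_eq_conjTranspose, conjTranspose_eq_transpose_of_trivial] at this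
  · have := hH.conjStarAlgAut_star_eigenvectorUnitary
    rw [Unitary.conjStarAlgAut_star_apply] at this
    rw [star_eq_conjTranspose, conjTranspose_eq_transpose_of_trivial] at this
    simpa using this

lemma sum_frobSq_matComm_diagonal_le {ι : Type*} [Fintype ι] (x : Fin n → ℝ)
    (C : ι → Matrix (Fin n) (Fin n) ℝ) (hC : ∀ r, (C r)ᵀ = C r) (μ : ℝ) (hμ : 0 ≤ μ)
    (hbound : ∀ X : Matrix (Fin n) (Fin n) ℝ, ∑ r, frobInner (C r) X ^ 2 ≤ μ * frobSq X) :
    ∑ r, frobSq (matComm (diagonal x) (C r))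
      ≤ frobSq (diagonal x) * (∑ r, frobSq (C r) + μ) := by
  have hswap : ∀ f : Fin n → Fin n → ι → ℝ,
      ∑ r, ∑ i, ∑ j, f i j r = ∑ i, ∑ j, ∑ r, f i j r := fun f => by
    rw [Finset.sum_comm]
    exact Finset.sum_congr rfl fun i _ => Finset.sum_comm
  have hentry : ∀ i j, i ≠ j → ∑ r, C r i j ^ 2 ≤ μ / 2 := by
    intro i j hij
    have h := hbound (single i j 1 + single j i 1)
    have h1 : ∀ r, frobInner (C r) (single i j 1 + single j i 1) = 2 * C r i j := fun r => by
      have hs : C r j i = C r i j := by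
        conv_lhs => rw [← hC r, transpose_apply]
      simp [frobInner, single_apply, mul_add, Finset.sum_add_distrib, ite_and, hs]
      ring
    have h2 : frobSq (single i j (1 : ℝ) + single j i 1 : Matrix (Fin n) (Fin n) ℝ) = 2 := by
      rw [← frobInner_self, frobInner_add_left]
      simp [frobInner, single_apply, mul_add, Finset.sum_add_distrib, ite_and, hij, hij.symm]
      norm_num
    simp only [h1, h2, mul_pow, ← Finset.mul_sum] at h
    linarith
  have key := sum_sq_sub_mul_le x (fun i j => ∑ r, C r i j ^ 2) (μ / 2) (by positivity)
    (fun i j => Finset.sum_nonneg fun r _ => sq_nonneg _) hentry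
  simp only [frobSq_matComm_diagonal, frobSq_diagonal]
  simp only [frobSq, hswap, ← Finset.mul_sum]
  linarith

/-- The commutator estimate of Lu: if the symmetric matrices `C r` satisfy the Bessel-type bound with
constant `μ`, then `∑ r, ‖[A, C r]‖² ≤ ‖A‖² * (∑ r, ‖C r‖² + μ)` for every symmetric `A`. -/
lemma sum_frobSq_matComm_le {ι : Type*} [Fintype ι] {A : Matrix (Fin n) (Fin n) ℝ} (hA : Aᵀ = A)
    (C : ι → Matrix (Fin n) (Fin n) ℝ) (hC : ∀ r, (C r)ᵀ = C r) (μ : ℝ) (hμ : 0 ≤ μ)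
    (hbound : ∀ X : Matrix (Fin n) (Fin n) ℝ, ∑ r, frobInner (C r) X ^ 2 ≤ μ * frobSq X) :
    ∑ r, frobSq (matComm A (C r)) ≤ frobSq A * (∑ r, frobSq (C r) + μ) := by
  obtain ⟨U, x, hU, hx⟩ := exists_orthogonal_conj_eq_diagonal hA
  have hU' : Uᵀ * U = 1 := mul_eq_one_comm.1 hU
  have key := sum_frobSq_matComm_diagonal_le x (fun r => Uᵀ * C r * U)
    (fun r => by simp only [transpose_mul, transpose_transpose, hC, Matrix.mul_assoc]) μ hμ ?_
  · simpa only [← hx, matComm_conj hU, frobSq_conj hU] using key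
  · intro X
    have hX : Uᵀ * (U * X * Uᵀ) * U = X := by
      calc Uᵀ * (U * X * Uᵀ) * U = (Uᵀ * U) * X * (Uᵀ * U) := by simp only [Matrix.mul_assoc]
        _ = X := by rw [hU', Matrix.one_mul, Matrix.mul_one]
    have h := hbound (U * X * Uᵀ)
    rw [← frobSq_conj hU, hX] at h
    simp only [← frobInner_conj hU (C _), hX] at h
    exact h

end Frobenius

section Extremal

lemma exists_isMax_on_sphere {κ : Type*} [Fintype κ] {f : (κ → ℝ) → ℝ} (hf : Continuous f)
    {s : Set (κ → ℝ)} (hs : IsClosed s) (hne : ∃ x ∈ s, ∑ k, x k ^ 2 = 1) :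
    ∃ x ∈ s, ∑ k, x k ^ 2 = 1 ∧ ∀ y ∈ s, ∑ k, y k ^ 2 = 1 → f y ≤ f x := by
  have hcube : IsCompact (Set.univ.pi fun _ : κ => Set.Icc (-1 : ℝ) 1) :=
    isCompact_univ_pi fun _ => isCompact_Icc
  have hclosed : IsClosed (s ∩ {x : κ → ℝ | ∑ k, x k ^ 2 = 1}) :=
    hs.inter (isClosed_eq (by fun_prop) continuous_const)
  have hcompact : IsCompact (s ∩ {x : κ → ℝ | ∑ k, x k ^ 2 = 1}) := by
    refine hcube.of_isClosed_subset hclosed ?_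
    rintro x ⟨-, hx⟩ k -
    have hx : ∑ k, x k ^ 2 = 1 := hx
    have hk : x k ^ 2 ≤ 1 := by
      rw [← hx]
      exact Finset.single_le_sum (f := fun k => x k ^ 2) (fun k _ => sq_nonneg _)
        (Finset.mem_univ k)
    exact Set.mem_Icc.2 (abs_le.1 ((sq_le_one_iff_abs_le_one _).1 hk))
  obtain ⟨x₀, hx₀, hx₀'⟩ := hne
  obtain ⟨x, ⟨hxs, hx⟩, hmax⟩ := hcompact.exists_isMaxOn ⟨x₀, hx₀, hx₀'⟩ hf.continuousOn
  exact ⟨x, hxs, hx, fun y hy hy' => hmax ⟨hy, hy'⟩⟩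

variable {n : ℕ} {ι : Type*} [Fintype ι]

/-- A unit vector `v` maximizing `‖∑ r, v r • A r‖`. -/
lemma exists_top_direction [Nonempty ι] (A : ι → Matrix (Fin n) (Fin n) ℝ) :
    ∃ v : ι → ℝ, ∑ r, v r ^ 2 = 1 ∧ ∀ w : ι → ℝ,
      frobSq (∑ r, w r • A r) ≤ frobSq (∑ r, v r • A r) * ∑ r, w r ^ 2 := by
  classical
  have hcont : Continuous fun w : ι → ℝ => frobSq (∑ r, w r • A r) := by
    simp only [frobSq, Matrix.sum_apply, Matrix.smul_apply, smul_eq_mul]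
    fun_prop
  have hne : ∃ x ∈ (Set.univ : Set (ι → ℝ)), ∑ k, x k ^ 2 = 1 :=
    ⟨Pi.single (Classical.arbitrary ι) 1, Set.mem_univ _, by simp [Pi.single_apply, ite_pow]⟩
  obtain ⟨v, -, hv, hmax⟩ := exists_isMax_on_sphere hcont isClosed_univ hne
  refine ⟨v, hv, fun w => ?_⟩
  rcases (Finset.sum_nonneg fun r _ => sq_nonneg (w r)).eq_or_lt with h | h
  · have hw : ∀ r, w r = 0 := fun r => by
      simpa using (Finset.sum_eq_zero_iff_of_nonneg fun r _ => sq_nonneg (w r)).1 h.symm r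
        (Finset.mem_univ r)
    simp [hw, frobSq]
  · have h1 := hmax (fun r => (√(∑ r, w r ^ 2))⁻¹ * w r) (Set.mem_univ _) (by
      simp only [mul_pow, ← Finset.mul_sum, inv_pow, Real.sq_sqrt h.le]
      exact inv_mul_cancel₀ h.ne')
    simp only [mul_smul, ← Finset.smul_sum, frobSq_smul, inv_pow, Real.sq_sqrt h.le] at h1
    rwa [inv_mul_le_iff₀ h, mul_comm] at h1

lemma matComm_smul_left (c : ℝ) (A B : Matrix (Fin n) (Fin n) ℝ) :
    matComm (c • A) B = c • matComm A B := by
  simp only [matComm, Matrix.smul_mul, Matrix.mul_smul, smul_sub]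

lemma matComm_skew (A B : Matrix (Fin n) (Fin n) ℝ) : matComm A B = -matComm B A := by
  simp only [matComm, neg_sub]

lemma matComm_self (A : Matrix (Fin n) (Fin n) ℝ) : matComm A A = 0 := sub_self _

lemma matComm_smul_right (c : ℝ) (A B : Matrix (Fin n) (Fin n) ℝ) :
    matComm A (c • B) = c • matComm A B := by
  simp only [matComm, Matrix.smul_mul, Matrix.mul_smul, smul_sub]

lemma matComm_sub_right (A B C : Matrix (Fin n) (Fin n) ℝ) :
    matComm A (B - C) = matComm A B - matComm A C := by
  simp only [matComm, Matrix.sub_mul, Matrix.mul_sub]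
  abel

lemma matComm_sum_left (A : ι → Matrix (Fin n) (Fin n) ℝ) (B : Matrix (Fin n) (Fin n) ℝ) :
    matComm (∑ r, A r) B = ∑ r, matComm (A r) B := by
  simp only [matComm, Finset.sum_mul, Finset.mul_sum, Finset.sum_sub_distrib]

/-- Bessel's inequality with respect to a top direction. -/
lemma sum_frobInner_sq_le {A : ι → Matrix (Fin n) (Fin n) ℝ} {μ : ℝ} (hμ0 : 0 ≤ μ)
    (hμ : ∀ w : ι → ℝ, frobSq (∑ r, w r • A r) ≤ μ * ∑ r, w r ^ 2)
    (X : Matrix (Fin n) (Fin n) ℝ) : ∑ r, frobInner (A r) X ^ 2 ≤ μ * frobSq X := by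
  set q := ∑ r, frobInner (A r) X ^ 2 with hq
  have hw := hμ fun r => frobInner (A r) X
  have hinner : frobInner (∑ r, frobInner (A r) X • A r) X = q := by
    simp only [frobInner_sum_left, frobInner_smul_left, hq, sq]
  have hcs := frobInner_sq_le (∑ r, frobInner (A r) X • A r) X
  rw [hinner] at hcs
  have hq0 : 0 ≤ q := Finset.sum_nonneg fun r _ => sq_nonneg _
  rcases hq0.eq_or_lt with h | h
  · rw [← h]
    exact mul_nonneg hμ0 (frobSq_nonneg X)
  · have := hcs.trans (mul_le_mul_of_nonneg_right hw (frobSq_nonneg X))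
    refine le_of_mul_le_mul_right ?_ h
    linarith

/-- The commutators with a top combination `W = ∑ r, v r • A r` are controlled by
`‖W‖² * ∑ r, ‖A r‖²`. -/
lemma sum_frobSq_matComm_top_le {A : ι → Matrix (Fin n) (Fin n) ℝ} (hA : ∀ r, (A r)ᵀ = A r)
    {v : ι → ℝ} (hv : ∑ r, v r ^ 2 = 1)
    (hmax : ∀ w : ι → ℝ, frobSq (∑ r, w r • A r) ≤ frobSq (∑ r, v r • A r) * ∑ r, w r ^ 2) :
    ∑ s, frobSq (matComm (∑ r, v r • A r) (A s))
      ≤ frobSq (∑ r, v r • A r) * ∑ r, frobSq (A r) := by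
  set W := ∑ r, v r • A r with hWdef
  have hW : Wᵀ = W := by simp only [hWdef, transpose_sum, transpose_smul, hA]
  have hinner : ∀ X, ∑ r, v r * frobInner (A r) X = frobInner W X := fun X => by
    simp only [hWdef, frobInner_sum_left, frobInner_smul_left]
  have hexp : ∀ X, ∑ r, frobInner (A r - v r • W) X ^ 2
      = ∑ r, frobInner (A r) X ^ 2 - frobInner W X ^ 2 := fun X => by
    have h : ∀ r, frobInner (A r - v r • W) X ^ 2 = frobInner (A r) X ^ 2
        - 2 * frobInner W X * (v r * frobInner (A r) X) + frobInner W X ^ 2 * v r ^ 2 := fun r => by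
      rw [frobInner_sub_left, frobInner_smul_left]
      ring
    simp only [h, Finset.sum_add_distrib, Finset.sum_sub_distrib, ← Finset.mul_sum, hinner, hv]
    ring
  have hnorm : ∑ r, frobSq (A r - v r • W) = ∑ r, frobSq (A r) - frobSq W := by
    have h : ∀ r, frobSq (A r - v r • W)
        = frobSq (A r) - 2 * (v r * frobInner (A r) W) + frobSq W * v r ^ 2 := fun r => by
      rw [sub_eq_add_neg, ← neg_smul, frobSq_add_smul]
      ring
    simp only [h, Finset.sum_add_distrib, Finset.sum_sub_distrib, ← Finset.mul_sum, hinner, hv,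
      frobInner_self]
    ring
  have key := sum_frobSq_matComm_le hW (fun r => A r - v r • W)
    (fun r => by rw [transpose_sub, transpose_smul, hA, hW]) (frobSq W) (frobSq_nonneg W)
    (fun X => by
      rw [hexp]
      linarith [sum_frobInner_sq_le (frobSq_nonneg W) hmax X, sq_nonneg (frobInner W X)])
  simpa only [matComm_sub_right, matComm_smul_right, matComm_self, smul_zero, sub_zero, hnorm,
    sub_add_cancel] using key

/-- First-order growth of the commutator sum under stretching along `v`. -/
lemma sum_frobSq_matComm_add_smul_ge (A : ι → Matrix (Fin n) (Fin n) ℝ) (v : ι → ℝ) (t : ℝ) :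
    ∑ r, ∑ s, frobSq (matComm (A r) (A s))
        + 4 * t * ∑ s, frobSq (matComm (∑ r, v r • A r) (A s))
      ≤ ∑ r, ∑ s, frobSq (matComm (A r + (t * v r) • ∑ q, v q • A q)
          (A s + (t * v s) • ∑ q, v q • A q)) := by
  set W := ∑ r, v r • A r with hWdef
  have hexp : ∀ r s, matComm (A r + (t * v r) • W) (A s + (t * v s) • W)
      = matComm (A r) (A s) + t • (v r • matComm W (A s) - v s • matComm W (A r)) := fun r s => by
    simp only [matComm, Matrix.add_mul, Matrix.mul_add, Matrix.smul_mul, Matrix.mul_smul]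
    module
  have hfirst : ∑ r, ∑ s, v r * frobInner (matComm (A r) (A s)) (matComm W (A s))
      = ∑ s, frobSq (matComm W (A s)) := by
    rw [Finset.sum_comm]
    refine Finset.sum_congr rfl fun s _ => ?_
    rw [← frobInner_self, hWdef]
    conv_rhs => rw [matComm_sum_left, frobInner_sum_left]
    simp only [matComm_smul_left, frobInner_smul_left, matComm_sum_left]
  have hsecond : ∑ r, ∑ s, v s * frobInner (matComm (A r) (A s)) (matComm W (A r))
      = -∑ s, frobSq (matComm W (A s)) := by
    rw [← hfirst, Finset.sum_comm, ← Finset.sum_neg_distrib]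
    refine Finset.sum_congr rfl fun r _ => ?_
    rw [← Finset.sum_neg_distrib]
    refine Finset.sum_congr rfl fun s _ => ?_
    rw [matComm_skew (A s), ← neg_one_smul ℝ, frobInner_smul_left]
    ring
  have hle : ∀ r s, frobSq (matComm (A r) (A s))
      + 2 * t * (v r * frobInner (matComm (A r) (A s)) (matComm W (A s))
        - v s * frobInner (matComm (A r) (A s)) (matComm W (A r)))
      ≤ frobSq (matComm (A r + (t * v r) • W) (A s + (t * v s) • W)) := fun r s => by
    rw [hexp, frobSq_add_smul, frobInner_sub_right, frobInner_smul_right, frobInner_smul_right]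
    exact le_add_of_nonneg_right (mul_nonneg (sq_nonneg t) (frobSq_nonneg _))
  refine le_trans (le_of_eq ?_) (Finset.sum_le_sum fun r _ => Finset.sum_le_sum fun s _ => hle r s)
  have hfactor : ∀ f g : ι → ι → ℝ, ∑ r, ∑ s, 2 * t * (f r s - g r s)
      = 2 * t * (∑ r, ∑ s, f r s - ∑ r, ∑ s, g r s) := fun f g => by
    simp only [mul_sub, Finset.sum_sub_distrib, Finset.mul_sum]
  simp only [Finset.sum_add_distrib]
  rw [hfactor, hfirst, hsecond]
  ring

lemma sum_frobSq_add_smul (A : ι → Matrix (Fin n) (Fin n) ℝ) {v : ι → ℝ} (hv : ∑ r, v r ^ 2 = 1)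
    (t : ℝ) :
    ∑ r, frobSq (A r + (t * v r) • ∑ q, v q • A q)
      = ∑ r, frobSq (A r) + (2 * t + t ^ 2) * frobSq (∑ q, v q • A q) := by
  have hinner : ∑ r, v r * frobInner (A r) (∑ q, v q • A q) = frobSq (∑ q, v q • A q) := by
    rw [← frobInner_self]
    conv_rhs => rw [frobInner_sum_left]
    simp only [frobInner_smul_left]
  have h : ∀ r, frobSq (A r + (t * v r) • ∑ q, v q • A q) = frobSq (A r)
      + 2 * t * (v r * frobInner (A r) (∑ q, v q • A q))
      + t ^ 2 * frobSq (∑ q, v q • A q) * v r ^ 2 := fun r => by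
    rw [frobSq_add_smul]
    ring
  simp only [h, Finset.sum_add_distrib, ← Finset.mul_sum, hinner, hv]
  ring

lemma sum_frobSq_matComm_smul (c : ℝ) (A : ι → Matrix (Fin n) (Fin n) ℝ) :
    ∑ r, ∑ s, frobSq (matComm (c • A r) (c • A s))
      = c ^ 4 * ∑ r, ∑ s, frobSq (matComm (A r) (A s)) := by
  simp only [matComm_smul_left, matComm_smul_right, frobSq_smul, Finset.mul_sum]
  refine Finset.sum_congr rfl fun r _ => Finset.sum_congr rfl fun s _ => ?_
  ring

/-- Among symmetric tuples of total squared norm one, one maximizes the commutator sum. -/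
lemma exists_extremal_tuple {B : ι → Matrix (Fin n) (Fin n) ℝ} (hB : ∀ r, (B r)ᵀ = B r)
    (hpos : 0 < ∑ r, frobSq (B r)) :
    ∃ A : ι → Matrix (Fin n) (Fin n) ℝ, (∀ r, (A r)ᵀ = A r) ∧ ∑ r, frobSq (A r) = 1 ∧
      ∀ C : ι → Matrix (Fin n) (Fin n) ℝ, (∀ r, (C r)ᵀ = C r) → 0 < ∑ r, frobSq (C r) →
        ∑ r, ∑ s, frobSq (matComm (C r) (C s))
          ≤ (∑ r, ∑ s, frobSq (matComm (A r) (A s))) * (∑ r, frobSq (C r)) ^ 2 := by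
  let T : (ι × Fin n × Fin n → ℝ) → ι → Matrix (Fin n) (Fin n) ℝ :=
    fun x r => of fun i j => x (r, i, j)
  let s : Set (ι × Fin n × Fin n → ℝ) := {x | ∀ r i j, x (r, j, i) = x (r, i, j)}
  have hT : ∀ x ∈ s, ∀ r, (T x r)ᵀ = T x r := fun x hx r => by
    ext i j
    exact hx r i j
  have hsum : ∀ x, ∑ k, x k ^ 2 = ∑ r, frobSq (T x r) := fun x => by
    simp only [Fintype.sum_prod_type, frobSq, T, of_apply]
  have hnormalize : ∀ C : ι → Matrix (Fin n) (Fin n) ℝ, (∀ r, (C r)ᵀ = C r) →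
      0 < ∑ r, frobSq (C r) → ∃ x ∈ s, ∑ k, x k ^ 2 = 1 ∧
        ∀ r, T x r = (√(∑ r, frobSq (C r)))⁻¹ • C r := by
    intro C hC hCpos
    have hTx : ∀ r, T (fun p => (√(∑ r, frobSq (C r)))⁻¹ * C p.1 p.2.1 p.2.2) r
        = (√(∑ r, frobSq (C r)))⁻¹ • C r := fun r => by
      ext i j
      simp [T]
    refine ⟨fun p => (√(∑ r, frobSq (C r)))⁻¹ * C p.1 p.2.1 p.2.2, fun r i j => ?_, ?_, hTx⟩
    · have h : C r j i = C r i j := by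
        conv_lhs => rw [← hC r, transpose_apply]
      simp only [h]
    · simp only [hsum, hTx, frobSq_smul, ← Finset.mul_sum, inv_pow, Real.sq_sqrt hCpos.le]
      exact inv_mul_cancel₀ hCpos.ne'
  have hclosed : IsClosed s := by
    simp only [s, Set.ofPred_forall]
    exact isClosed_iInter fun r => isClosed_iInter fun i => isClosed_iInter fun j =>
      isClosed_eq (continuous_apply _) (continuous_apply _)
  have hcont : Continuous fun x => ∑ r, ∑ s, frobSq (matComm (T x r) (T x s)) := by
    simp only [frobSq, matComm, Matrix.sub_apply, Matrix.mul_apply, T, of_apply]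
    fun_prop
  obtain ⟨x₀, hx₀, hx₀', -⟩ := hnormalize B hB hpos
  obtain ⟨x, hxs, hx, hmax⟩ := exists_isMax_on_sphere hcont hclosed ⟨x₀, hx₀, hx₀'⟩
  refine ⟨T x, hT x hxs, by rw [← hsum, hx], fun C hC hCpos => ?_⟩
  obtain ⟨y, hys, hy, hyC⟩ := hnormalize C hC hCpos
  have h := hmax y hys hy
  simp only [hyC, sum_frobSq_matComm_smul] at h
  have h4 : (√(∑ r, frobSq (C r)))⁻¹ ^ 4 = ((∑ r, frobSq (C r)) ^ 2)⁻¹ := by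
    rw [inv_pow, show 4 = 2 * 2 from rfl, pow_mul, Real.sq_sqrt hCpos.le]
  rwa [h4, inv_mul_le_iff₀ (by positivity), mul_comm] at h

lemma le_one_of_stretch_bound {a l : ℝ} (hl : 0 < l)
    (h : ∀ ε, 0 < ε → 0 < 1 + (2 * -ε + (-ε) ^ 2) * l →
      a - 4 * ε * l ≤ a * (1 + (2 * -ε + (-ε) ^ 2) * l) ^ 2) : a ≤ 1 := by
  by_contra! hlt
  obtain ⟨ε, hε⟩ : ∃ ε, ε = (a - 1) / (4 * a * (l + 1)) := ⟨_, rfl⟩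
  have ha0 : 0 < a := by linarith
  have hεpos : 0 < ε := hε ▸ div_pos (by linarith) (by positivity)
  have hεmul : a * (ε * (l + 1)) = (a - 1) / 4 := by
    rw [hε]
    field_simp
  have hεl : ε * (l + 1) < 1 / 4 := by
    refine lt_of_mul_lt_mul_left ?_ ha0.le
    linarith
  have hεl' : 0 < ε * l := mul_pos hεpos hl
  have hε1 : ε < 1 := by linarith
  have h1 := h ε hεpos (by linarith [mul_pos hεpos hεl'])
  have h2 : (2 * ε - ε ^ 2) ^ 2 ≤ 4 * ε ^ 2 := by
    have : 0 ≤ ε ^ 3 * (4 - ε) := mul_nonneg (by positivity) (by linarith)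
    linarith
  have h3 := mul_le_mul_of_nonneg_left h2 (mul_nonneg ha0.le (sq_nonneg l))
  have h4 : a * (1 - ε / 2 - ε * l) ≤ 1 := by
    refine le_of_mul_le_mul_right ?_ (show 0 < 4 * ε * l by positivity)
    linarith
  linarith [mul_pos ha0 hεpos]

end Extremal

/-- The DDVV matrix inequality for real symmetric matrices. -/
theorem ddvv_symmetric (n m : ℕ) (hn : 0 < n) (hm : 0 < m)
    (B : Fin m → Matrix (Fin n) (Fin n) ℝ)
    (hsymm : ∀ r, (B r)ᵀ = B r) :
    ∑ r, ∑ s, frobSq (matComm (B r) (B s)) ≤ (∑ r, frobSq (B r)) ^ 2 := by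
  have hS : 0 ≤ ∑ r, frobSq (B r) := Finset.sum_nonneg fun r _ => frobSq_nonneg _
  rcases hS.eq_or_lt with h0 | hpos
  · have hB : ∀ r, B r = 0 := fun r => frobSq_eq_zero
      ((Finset.sum_eq_zero_iff_of_nonneg fun r _ => frobSq_nonneg (B r)).1 h0.symm r
        (Finset.mem_univ r))
    simp [hB, matComm, frobSq]
  obtain ⟨A, hA, hA1, hmax⟩ := exists_extremal_tuple hsymm hpos
  have hle := hmax B hsymm hpos
  set a := ∑ r, ∑ s, frobSq (matComm (A r) (A s)) with ha
  suffices h : a ≤ 1 from hle.trans (mul_le_of_le_one_left (sq_nonneg _) h)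
  have : Nonempty (Fin m) := ⟨⟨0, hm⟩⟩
  obtain ⟨v, hv, hvmax⟩ := exists_top_direction A
  have hC := sum_frobSq_matComm_top_le hA hv hvmax
  have hstretch := sum_frobSq_matComm_add_smul_ge A v
  have hnorm := sum_frobSq_add_smul A hv
  set W := ∑ r, v r • A r with hW
  rw [hA1, mul_one] at hC
  have hWsymm : Wᵀ = W := by simp only [hW, transpose_sum, transpose_smul, hA]
  have hWpos : 0 < frobSq W := by
    refine (frobSq_nonneg W).lt_of_ne fun h => ?_
    have hzero : ∀ r, frobSq (A r) = 0 := fun r => by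
      have hr := hvmax (Pi.single r 1)
      rw [← h, zero_mul] at hr
      simp only [Pi.single_apply, ite_smul, one_smul, zero_smul, Finset.sum_ite_eq',
        Finset.mem_univ, if_true] at hr
      exact le_antisymm hr (frobSq_nonneg _)
    simp [hzero] at hA1
  refine le_one_of_stretch_bound hWpos fun ε hε hN => ?_
  have hbound := (hstretch (-ε)).trans (hmax (fun r => A r + (-ε * v r) • W)
    (fun r => by rw [transpose_add, transpose_smul, hA, hWsymm]) (by rwa [hnorm, hA1]))
  rw [hnorm, hA1] at hbound
  linarith [mul_le_mul_of_nonneg_left hC hε.le]
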